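/- Let A ⊆ ℂ be an open annular region (connected, complement has exactly one bounded component) on which f is holomorphic, zero-free, and f' is zero-free, and suppose the winding number of f around the bounded complementary component equals N ≥ 1 (i.e., the change of arg f along a core curve is 2πN). Then there exists a holomorphic function φ on A with φ^N = f. -/

import Mathlib

open Real
open Set Filter Topology MeasureTheory Metric
open scoped Interval

/-- The divided difference of a holomorphic function is jointly continuous. -/
lemma continuousOn_uncurry_dslope {A : Set ℂ} (hA : IsOpen A) {φ : ℂ → ℂ}
    (hφ : DifferentiableOn ℂ φ A) :
    ContinuousOn (Function.uncurry (dslope φ)) (A ×ˢ A) := by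
  rintro ⟨a, b⟩ ⟨ha, hb⟩
  apply ContinuousAt.continuousWithinAt
  have hca := (hφ.differentiableAt (hA.mem_nhds ha)).continuousAt
  have hcb := (hφ.differentiableAt (hA.mem_nhds hb)).continuousAt
  rcases eq_or_ne a b with rfl | hab
  · have hs : HasStrictDerivAt φ (deriv φ a) a :=
      (hφ.analyticAt (hA.mem_nhds ha)).hasStrictDerivAt
    have hd : ContinuousAt (deriv φ) a :=
      ((hφ.deriv hA).differentiableAt (hA.mem_nhds ha)).continuousAt
    rw [Metric.continuousAt_iff']
    intro ε hε
    have h1 := hs.isLittleO.def (half_pos hε)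
    have h2 : ∀ᶠ p : ℂ × ℂ in 𝓝 (a, a), dist (deriv φ p.1) (deriv φ a) < ε :=
      (Metric.continuousAt_iff'.1 (hd.comp_of_eq (continuousAt_fst (p := (a, a))) rfl)) ε hε
    filter_upwards [h1, h2] with ⟨x, y⟩ h1 h2
    simp only [Function.uncurry_apply_pair, dslope_same] at h1 h2 ⊢
    rcases eq_or_ne y x with rfl | hyx
    · simpa using h2
    · rw [dslope_of_ne _ hyx, slope_def_field, dist_eq_norm]
      have hne : x - y ≠ 0 := sub_ne_zero.2 hyx.symm
      have hne' : y - x ≠ 0 := sub_ne_zero.2 hyx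
      have : (φ y - φ x) / (y - x) - deriv φ a
          = (φ x - φ y - (x - y) * deriv φ a) / (x - y) := by
        field_simp
        ring
      rw [this, norm_div, div_lt_iff₀ (norm_pos_iff.2 hne)]
      have h3 : 0 < ‖x - y‖ := norm_pos_iff.2 hne
      have h4 : ‖φ x - φ y - (x - y) * deriv φ a‖ ≤ ε / 2 * ‖x - y‖ := by simpa using h1
      nlinarith
  · have hev : ∀ᶠ p : ℂ × ℂ in 𝓝 (a, b), p.2 ≠ p.1 :=
      (isOpen_ne_fun continuous_snd continuous_fst).mem_nhds hab.symm
    have : ContinuousAt (fun p : ℂ × ℂ => (φ p.2 - φ p.1) / (p.2 - p.1)) (a, b) := by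
      refine ContinuousAt.div (ContinuousAt.sub ?_ ?_) (by fun_prop) (sub_ne_zero.2 hab.symm)
      · exact hcb.comp_of_eq (continuousAt_snd (p := (a, b))) rfl
      · exact hca.comp_of_eq (continuousAt_fst (p := (a, b))) rfl
    refine this.congr ?_
    filter_upwards [hev] with p hp
    simp only [Function.uncurry]
    rw [dslope_of_ne _ hp, slope_def_field]

/-- Integrals of holomorphic functions depending continuously on a parameter are holomorphic. -/
lemma differentiableAt_intervalIntegral_of_continuousOn {F : ℂ → ℝ → ℂ} {U : Set ℂ}
    (hU : IsOpen U) {z₀ : ℂ} (hz₀ : z₀ ∈ U)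
    (hc : ContinuousOn (Function.uncurry F) (U ×ˢ Icc (0 : ℝ) 1))
    (hd : ∀ t ∈ Icc (0 : ℝ) 1, DifferentiableOn ℂ (fun z => F z t) U) :
    DifferentiableAt ℂ (fun z => ∫ t in (0 : ℝ)..1, F z t) z₀ := by
  obtain ⟨r, hr, hrU⟩ := Metric.nhds_basis_closedBall.mem_iff.1 (hU.mem_nhds hz₀)
  obtain ⟨M, hM⟩ := ((isCompact_closedBall z₀ r).prod isCompact_Icc).exists_bound_of_continuousOn
    (hc.mono (prod_mono hrU Subset.rfl))
  have hct : ∀ z ∈ U, ContinuousOn (F z) (Icc 0 1) := fun z hz =>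
    hc.comp (f := fun t : ℝ => (z, t)) (by fun_prop) fun t ht => ⟨hz, ht⟩
  have hΙ : Ι (0 : ℝ) 1 ⊆ Icc 0 1 := by
    rw [uIoc_of_le zero_le_one]; exact Ioc_subset_Icc_self
  have hm : ∀ z ∈ U, AEStronglyMeasurable (F z) (volume.restrict (Ι (0 : ℝ) 1)) := fun z hz =>
    ((hct z hz).mono hΙ).aestronglyMeasurable measurableSet_uIoc
  have hderiv : ∀ t ∈ Ι (0 : ℝ) 1, ∀ z ∈ U,
      HasDerivAt (fun x => F x t) (deriv (fun x => F x t) z) z := fun t ht z hz =>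
    ((hd t (hΙ ht)).differentiableAt (hU.mem_nhds hz)).hasDerivAt
  refine (intervalIntegral.hasDerivAt_integral_of_dominated_loc_of_deriv_le
    (F' := fun z t => deriv (fun x => F x t) z) (bound := fun _ => M / (r / 2))
    (ball_mem_nhds z₀ (half_pos hr)) ?_ ?_ ?_ ?_ intervalIntegrable_const ?_).2.differentiableAt
  · filter_upwards [hU.mem_nhds hz₀] with z hz using hm z hz
  · exact ((hct z₀ hz₀).mono (by rw [uIcc_of_le zero_le_one])).intervalIntegrable
  · obtain ⟨u, -, hu, hlim⟩ := exists_seq_strictAnti_tendsto' hr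
    have hu' : ∀ n, z₀ + (u n : ℂ) ∈ U := fun n => hrU <| by
      have := hu n
      simp [abs_of_pos this.1, this.2.le]
    have hseq : Tendsto (fun n => z₀ + (u n : ℂ)) atTop (𝓝[≠] z₀) := by
      refine tendsto_nhdsWithin_iff.2 ⟨?_, .of_forall fun n => ?_⟩
      · simpa using (Complex.continuous_ofReal.tendsto 0 |>.comp hlim).const_add z₀
      · simpa using (hu n).1.ne'
    refine aestronglyMeasurable_of_tendsto_ae atTop
      (f := fun n t => slope (fun x => F x t) z₀ (z₀ + u n)) (fun n => ?_) ?_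
    · simp only [slope_def_field]
      exact ((((hct _ (hu' n)).sub (hct _ hz₀)).div_const _).mono hΙ).aestronglyMeasurable
        measurableSet_uIoc
    · filter_upwards [ae_restrict_mem measurableSet_uIoc] with t ht
      exact (hasDerivAt_iff_tendsto_slope.1 (hderiv t ht z₀ hz₀)).comp hseq
  · refine .of_forall fun t ht z hz => ?_
    have hsub : closedBall z (r / 2) ⊆ closedBall z₀ r := by
      refine closedBall_subset_closedBall' ?_
      have := (mem_ball.1 hz).le
      linarith
    refine Complex.norm_deriv_le_of_forall_mem_sphere_norm_le (half_pos hr) ?_ fun w hw => ?_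
    · exact ((hd t (hΙ ht)).mono (hsub.trans hrU)).diffContOnCl_ball Subset.rfl
    · exact hM (w, t) ⟨hsub (sphere_subset_closedBall hw), hΙ ht⟩
  · refine .of_forall fun t ht z hz => hderiv t ht z (hrU ?_)
    exact ball_subset_closedBall.trans (closedBall_subset_closedBall (by linarith)) hz

/-- The integral of `φ` along the segment from `p` to `q`. -/
noncomputable def segmentIntegral (φ : ℂ → ℂ) (p q : ℂ) : ℂ :=
  ∫ t in (0 : ℝ)..1, φ (AffineMap.lineMap p q t) * (q - p)

lemma lineMap_mem_of_segment_subset {p q : ℂ} {K : Set ℂ} (h : segment ℝ p q ⊆ K) {t : ℝ}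
    (ht : t ∈ Icc (0 : ℝ) 1) : AffineMap.lineMap p q t ∈ K :=
  h (segment_eq_image_lineMap ℝ p q ▸ mem_image_of_mem _ ht)

lemma intervalIntegrable_segmentIntegrand {φ : ℂ → ℂ} {p q : ℂ}
    (hφ : ContinuousOn φ (segment ℝ p q)) :
    IntervalIntegrable (fun t : ℝ => φ (AffineMap.lineMap p q t) * (q - p)) volume 0 1 := by
  refine ContinuousOn.intervalIntegrable ?_
  rw [uIcc_of_le zero_le_one]
  refine ContinuousOn.mul (hφ.comp (by fun_prop) fun t ht => ?_) continuousOn_const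
  exact lineMap_mem_of_segment_subset Subset.rfl ht

lemma segmentIntegral_congr {φ ψ : ℂ → ℂ} {p q : ℂ} (h : EqOn φ ψ (segment ℝ p q)) :
    segmentIntegral φ p q = segmentIntegral ψ p q := by
  refine intervalIntegral.integral_congr fun t ht => ?_
  rw [uIcc_of_le zero_le_one] at ht
  simp only [h (lineMap_mem_of_segment_subset Subset.rfl ht)]

lemma segmentIntegral_sub_mul {φ ψ : ℂ → ℂ} {p q : ℂ} (a : ℂ)
    (hφ : ContinuousOn φ (segment ℝ p q)) (hψ : ContinuousOn ψ (segment ℝ p q)) :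
    segmentIntegral (fun w => φ w - a * ψ w) p q =
      segmentIntegral φ p q - a * segmentIntegral ψ p q := by
  unfold segmentIntegral
  rw [← intervalIntegral.integral_const_mul, ← intervalIntegral.integral_sub
    (intervalIntegrable_segmentIntegrand hφ) ((intervalIntegrable_segmentIntegrand hψ).const_mul a)]
  congr 1 with t
  ring

lemma segmentIntegral_eq_sub {φ P : ℂ → ℂ} {p q : ℂ}
    (hP : ∀ w ∈ segment ℝ p q, HasDerivAt P (φ w) w) (hφ : ContinuousOn φ (segment ℝ p q)) :
    segmentIntegral φ p q = P q - P p := by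
  have key := intervalIntegral.integral_eq_sub_of_hasDerivAt (a := 0) (b := 1)
    (f := fun t : ℝ => P (AffineMap.lineMap p q t))
    (f' := fun t : ℝ => φ (AffineMap.lineMap p q t) * (q - p)) (fun t ht => ?_)
    (intervalIntegrable_segmentIntegrand hφ)
  · simpa [segmentIntegral] using key
  · rw [uIcc_of_le zero_le_one] at ht
    have h := hP _ (lineMap_mem_of_segment_subset Subset.rfl ht)
    have := h.scomp t (AffineMap.hasDerivAt_lineMap (𝕜 := ℝ) (a := p) (b := q) (x := t))
    simpa [mul_comm, Function.comp_def] using this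

lemma differentiableAt_segmentIntegral {F : ℂ → ℂ → ℂ} {U : Set ℂ} (hU : IsOpen U) {z₀ p q : ℂ}
    (hz₀ : z₀ ∈ U) (hc : ContinuousOn (Function.uncurry F) (U ×ˢ segment ℝ p q))
    (hd : ∀ w ∈ segment ℝ p q, DifferentiableOn ℂ (fun z => F z w) U) :
    DifferentiableAt ℂ (fun z => segmentIntegral (F z) p q) z₀ := by
  refine differentiableAt_intervalIntegral_of_continuousOn hU hz₀ ?_ fun t ht => ?_
  · refine ContinuousOn.mul ?_ continuousOn_const
    exact hc.comp (f := fun x : ℂ × ℝ => (x.1, AffineMap.lineMap p q x.2)) (by fun_prop)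
      fun x hx => ⟨hx.1, lineMap_mem_of_segment_subset Subset.rfl hx.2⟩
  · exact (hd _ (lineMap_mem_of_segment_subset Subset.rfl ht)).mul_const _

lemma div_mem_slitPlane_of_notMem_segment {p q z w : ℂ} (hz : z ∉ segment ℝ p q)
    (hw : w ∈ segment ℝ p q) : (w - z) / (p - z) ∈ Complex.slitPlane := by
  have hp : p - z ≠ 0 := sub_ne_zero.2 fun h => hz (h ▸ left_mem_segment ℝ p q)
  rw [segment_eq_image_lineMap] at hw
  obtain ⟨t, ht, rfl⟩ := hw
  rw [Complex.mem_slitPlane_iff_not_le_zero]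
  intro hle
  obtain ⟨s, hs, hsz⟩ : ∃ s : ℝ, 0 ≤ s ∧ (AffineMap.lineMap p q t - z) / (p - z) = -(s : ℂ) := by
    refine ⟨-((AffineMap.lineMap p q t - z) / (p - z)).re, ?_, ?_⟩
    · have := (Complex.le_def.1 hle).1
      simpa using this
    · have := (Complex.le_def.1 hle).2
      apply Complex.ext <;> simp_all
  refine hz ((convex_segment p q).segment_subset (left_mem_segment ℝ p q)
    (lineMap_mem_of_segment_subset Subset.rfl ht) ?_)
  rw [segment_eq_image_lineMap]
  refine ⟨1 / (1 + s), ⟨by positivity, by rw [div_le_one (by positivity)]; linarith⟩, ?_⟩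
  have h1 : (1 + s : ℂ) ≠ 0 := by exact_mod_cast (by positivity : (1 + s : ℝ) ≠ 0)
  rw [div_eq_iff hp] at hsz
  have h2 : (AffineMap.lineMap p q t : ℂ) = z - s * (p - z) := by linear_combination hsz
  rw [h2, AffineMap.lineMap_apply]
  simp
  field_simp
  ring

lemma segmentIntegral_inv_sub {p q z : ℂ} (hz : z ∉ segment ℝ p q) :
    segmentIntegral (fun w => (w - z)⁻¹) p q = Complex.log ((q - z) / (p - z)) := by
  have hne : ∀ w ∈ segment ℝ p q, w - z ≠ 0 := fun w hw => sub_ne_zero.2 fun h => hz (h ▸ hw)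
  have hp := hne p (left_mem_segment ℝ p q)
  rw [segmentIntegral_eq_sub (P := fun w => Complex.log ((w - z) / (p - z)))]
  · simp [div_self hp]
  · intro w hw
    have := (((hasDerivAt_id w).sub_const z).div_const (p - z)).clog
      (div_mem_slitPlane_of_notMem_segment hz hw)
    refine HasDerivAt.congr_deriv this ?_
    have := hne w hw
    change 1 / (p - z) / ((w - z) / (p - z)) = (w - z)⁻¹
    field_simp
  · exact ContinuousOn.inv₀ (by fun_prop) hne

/-- The integral of `φ` along a formal integer combination of oriented segments. -/
noncomputable def chainIntegral (φ : ℂ → ℂ) (c : (ℂ × ℂ) →₀ ℤ) : ℂ :=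
  c.sum fun e n => (n : ℂ) * segmentIntegral φ e.1 e.2

lemma chainIntegral_zero (φ : ℂ → ℂ) : chainIntegral φ 0 = 0 := Finsupp.sum_zero_index

lemma chainIntegral_single (φ : ℂ → ℂ) (e : ℂ × ℂ) (n : ℤ) :
    chainIntegral φ (Finsupp.single e n) = n * segmentIntegral φ e.1 e.2 :=
  Finsupp.sum_single_index (by simp)

lemma chainIntegral_add (φ : ℂ → ℂ) (c d : (ℂ × ℂ) →₀ ℤ) :
    chainIntegral φ (c + d) = chainIntegral φ c + chainIntegral φ d :=
  Finsupp.sum_add_index' (by simp) (by intros; push_cast; ring)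

lemma chainIntegral_sub (φ : ℂ → ℂ) (c d : (ℂ × ℂ) →₀ ℤ) :
    chainIntegral φ (c - d) = chainIntegral φ c - chainIntegral φ d :=
  Finsupp.sum_sub_index (by intros; push_cast; ring)

lemma chainIntegral_zsmul (φ : ℂ → ℂ) (k : ℤ) (c : (ℂ × ℂ) →₀ ℤ) :
    chainIntegral φ (k • c) = k * chainIntegral φ c := by
  unfold chainIntegral
  rw [Finsupp.sum_smul_index' (by simp), Finsupp.mul_sum]
  refine Finsupp.sum_congr fun e _ => ?_
  simp [mul_assoc]

/-- All segments occurring in the chain `c` lie in `K`. -/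
def ChainIn (K : Set ℂ) (c : (ℂ × ℂ) →₀ ℤ) : Prop :=
  ∀ e ∈ c.support, segment ℝ e.1 e.2 ⊆ K

lemma ChainIn.mono {K L : Set ℂ} {c : (ℂ × ℂ) →₀ ℤ} (h : ChainIn K c) (hKL : K ⊆ L) :
    ChainIn L c := fun e he => (h e he).trans hKL

lemma ChainIn.add {K : Set ℂ} {c d : (ℂ × ℂ) →₀ ℤ} (hc : ChainIn K c) (hd : ChainIn K d) :
    ChainIn K (c + d) := fun e he =>
  (Finset.mem_union.1 (Finsupp.support_add he)).elim (hc e) (hd e)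

lemma ChainIn.sub {K : Set ℂ} {c d : (ℂ × ℂ) →₀ ℤ} (hc : ChainIn K c) (hd : ChainIn K d) :
    ChainIn K (c - d) := fun e he =>
  (Finset.mem_union.1 (Finsupp.support_sub he)).elim (hc e) (hd e)

lemma ChainIn.zsmul {K : Set ℂ} {c : (ℂ × ℂ) →₀ ℤ} (hc : ChainIn K c) (k : ℤ) :
    ChainIn K (k • c) := fun e he => hc e (Finsupp.support_smul he)

lemma ChainIn.single {K : Set ℂ} {p q : ℂ} (h : segment ℝ p q ⊆ K) (n : ℤ) :
    ChainIn K (Finsupp.single (p, q) n) := fun e he => by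
  obtain rfl := Finset.mem_singleton.1 (Finsupp.support_single_subset he)
  exact h

lemma chainIntegral_congr {φ ψ : ℂ → ℂ} {K : Set ℂ} {c : (ℂ × ℂ) →₀ ℤ} (hc : ChainIn K c)
    (h : EqOn φ ψ K) : chainIntegral φ c = chainIntegral ψ c :=
  Finsupp.sum_congr fun e he => by rw [segmentIntegral_congr (h.mono (hc e he))]

lemma chainIntegral_sub_mul {φ ψ : ℂ → ℂ} {K : Set ℂ} {c : (ℂ × ℂ) →₀ ℤ} (hc : ChainIn K c)
    (a : ℂ) (hφ : ContinuousOn φ K) (hψ : ContinuousOn ψ K) :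
    chainIntegral (fun w => φ w - a * ψ w) c = chainIntegral φ c - a * chainIntegral ψ c := by
  unfold chainIntegral
  rw [Finsupp.mul_sum, Finsupp.sum, Finsupp.sum, Finsupp.sum, ← Finset.sum_sub_distrib]
  refine Finset.sum_congr rfl fun e he => ?_
  rw [segmentIntegral_sub_mul a (hφ.mono (hc e he)) (hψ.mono (hc e he))]
  ring

lemma differentiableAt_chainIntegral {F : ℂ → ℂ → ℂ} {U K : Set ℂ} (hU : IsOpen U)
    {c : (ℂ × ℂ) →₀ ℤ} (hc : ChainIn K c) {z₀ : ℂ} (hz₀ : z₀ ∈ U)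
    (hF : ContinuousOn (Function.uncurry F) (U ×ˢ K))
    (hd : ∀ w ∈ K, DifferentiableOn ℂ (fun z => F z w) U) :
    DifferentiableAt ℂ (fun z => chainIntegral (F z) c) z₀ := by
  unfold chainIntegral Finsupp.sum
  refine DifferentiableAt.fun_sum fun e he => DifferentiableAt.const_mul ?_ _
  exact differentiableAt_segmentIntegral hU hz₀ (hF.mono (prod_mono Subset.rfl (hc e he)))
    fun w hw => hd w (hc e he hw)

lemma differentiableAt_chainIntegral_div_sub {ψ : ℂ → ℂ} {K : Set ℂ} (hK : IsCompact K)
    {c : (ℂ × ℂ) →₀ ℤ} (hc : ChainIn K c) (hψ : ContinuousOn ψ K) {z₀ : ℂ} (hz₀ : z₀ ∉ K) :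
    DifferentiableAt ℂ (fun z => chainIntegral (fun w => ψ w / (w - z)) c) z₀ := by
  refine differentiableAt_chainIntegral hK.isClosed.isOpen_compl hc hz₀ ?_ fun w hw => ?_
  · refine ContinuousOn.div (hψ.comp continuousOn_snd fun x hx => hx.2) (by fun_prop) ?_
    exact fun x hx => sub_ne_zero.2 fun h => hx.1 (h ▸ hx.2)
  · refine DifferentiableOn.div (by fun_prop) (by fun_prop) ?_
    exact fun z hz => sub_ne_zero.2 fun h => hz (h ▸ hw)

lemma tendsto_chainIntegral_div_sub {ψ : ℂ → ℂ} {K : Set ℂ} (hK : IsCompact K)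
    {c : (ℂ × ℂ) →₀ ℤ} (hc : ChainIn K c) (hψ : ContinuousOn ψ K) :
    Tendsto (fun z => chainIntegral (fun w => ψ w / (w - z)) c) (cocompact ℂ) (𝓝 0) := by
  obtain ⟨M, hM⟩ := hK.exists_bound_of_continuousOn hψ
  obtain ⟨R, hR⟩ := hK.isBounded.exists_norm_le
  have hz : Tendsto (fun z : ℂ => ‖z‖ - R) (cocompact ℂ) atTop :=
    tendsto_atTop_add_const_right _ _ tendsto_norm_cocompact_atTop
  unfold chainIntegral Finsupp.sum
  rw [← Finset.sum_const_zero (s := c.support)]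
  refine tendsto_finsetSum _ fun e he => ?_
  rw [← mul_zero ((c e : ℤ) : ℂ)]
  refine Tendsto.const_mul _ (squeeze_zero_norm' (a := fun z => M / (‖z‖ - R) * ‖e.2 - e.1‖) ?_ ?_)
  · filter_upwards [hz.eventually_gt_atTop 0] with z hz
    have := intervalIntegral.norm_integral_le_of_norm_le_const (a := 0) (b := 1)
      (C := M / (‖z‖ - R) * ‖e.2 - e.1‖)
      (f := fun t : ℝ => ψ (AffineMap.lineMap e.1 e.2 t) / (AffineMap.lineMap e.1 e.2 t - z)
        * (e.2 - e.1)) fun t ht => ?_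
    · simpa [segmentIntegral] using this
    · rw [uIoc_of_le zero_le_one] at ht
      have hw := lineMap_mem_of_segment_subset (hc e he) (Ioc_subset_Icc_self ht)
      rw [norm_mul, norm_div]
      have h1 := hR _ hw
      have h2 := norm_sub_norm_le z (AffineMap.lineMap e.1 e.2 t)
      rw [norm_sub_rev] at h2
      have h3 := hM _ hw
      have h4 := norm_nonneg (ψ (AffineMap.lineMap e.1 e.2 t))
      gcongr
      · linarith
      · linarith
  · simpa using (hz.const_div_atTop M).mul_const ‖e.2 - e.1‖

/-- The homology form of Cauchy's theorem, by Dixon's argument. -/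
theorem chainIntegral_eq_zero {A K : Set ℂ} (hA : IsOpen A) (hK : IsCompact K) (hKA : K ⊆ A)
    {c : (ℂ × ℂ) →₀ ℤ} (hc : ChainIn K c)
    (hW : ∀ z ∉ A, ∀ᶠ z' in 𝓝 z, chainIntegral (fun w => (w - z')⁻¹) c = 0)
    (hWinf : ∀ᶠ z in cocompact ℂ, chainIntegral (fun w => (w - z)⁻¹) c = 0)
    {φ : ℂ → ℂ} (hφ : DifferentiableOn ℂ φ A) : chainIntegral φ c = 0 := by
  classical
  set ψ : ℂ → ℂ := fun w => φ w * w with hψ_def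
  have hψ : DifferentiableOn ℂ ψ A := hφ.mul differentiableOn_id
  have hψK : ContinuousOn ψ K := hψ.continuousOn.mono hKA
  set H : ℂ → ℂ := fun z => if z ∈ A then chainIntegral (dslope ψ z) c
    else chainIntegral (fun w => ψ w / (w - z)) c with hH
  have hHK : ∀ z ∉ K, chainIntegral (fun w => (w - z)⁻¹) c = 0 →
      H z = chainIntegral (fun w => ψ w / (w - z)) c := by
    intro z hz hWz
    by_cases hzA : z ∈ A
    · have hne : ∀ w ∈ K, w - z ≠ 0 := fun w hw => sub_ne_zero.2 fun h => hz (h ▸ hw)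
      have h1 : EqOn (dslope ψ z) (fun w => ψ w / (w - z) - ψ z * (w - z)⁻¹) K := by
        intro w hw
        rw [dslope_of_ne _ (sub_ne_zero.1 (hne w hw)), slope_def_field]
        simp only
        ring
      rw [hH]
      simp only [if_pos hzA]
      rw [chainIntegral_congr hc h1, chainIntegral_sub_mul hc, hWz, mul_zero, sub_zero]
      · exact hψK.div (by fun_prop) hne
      · exact ContinuousOn.inv₀ (by fun_prop) hne
    · simp [hH, hzA]
  have hHd : Differentiable ℂ H := by
    intro z
    by_cases hzA : z ∈ A
    · have : DifferentiableAt ℂ (fun z => chainIntegral (dslope ψ z) c) z := by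
        refine differentiableAt_chainIntegral hA hc hzA
          ((continuousOn_uncurry_dslope hA hψ).mono (prod_mono Subset.rfl hKA)) fun w hw => ?_
        have h := (Complex.differentiableOn_dslope (hA.mem_nhds (hKA hw))).2 hψ
        refine h.congr fun z _ => ?_
        rcases eq_or_ne z w with rfl | hzw
        · rfl
        · rw [dslope_of_ne _ hzw, dslope_of_ne _ hzw.symm, slope_comm]
      refine this.congr_of_eventuallyEq ?_
      filter_upwards [hA.mem_nhds hzA] with z' hz'
      simp [hH, hz']
    · have hzK : z ∉ K := fun h => hzA (hKA h)
      refine (differentiableAt_chainIntegral_div_sub hK hc hψK hzK).congr_of_eventuallyEq ?_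
      filter_upwards [hW z hzA, hK.isClosed.isOpen_compl.mem_nhds hzK] with z' h1 h2
      exact hHK z' h2 h1
  have hH0 : H 0 = 0 := by
    refine hHd.apply_eq_of_tendsto_cocompact 0 ?_
    refine (tendsto_chainIntegral_div_sub hK hc hψK).congr' ?_
    filter_upwards [hWinf, hK.compl_mem_cocompact] with z h1 h2 using (hHK z h2 h1).symm
  rw [← hH0]
  by_cases h0 : (0 : ℂ) ∈ A
  · simp only [hH, if_pos h0]
    refine chainIntegral_congr hc fun w hw => ?_
    rcases eq_or_ne w 0 with rfl | hw0
    · rw [dslope_same]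
      have := ((hφ.differentiableAt (hA.mem_nhds h0)).hasDerivAt.mul (hasDerivAt_id (0 : ℂ))).deriv
      have h2 : deriv ψ 0 = _ := this
      rw [h2]; simp
    · rw [dslope_of_ne _ hw0, slope_def_field]
      simp [hψ_def, hw0]
  · simp only [hH, if_neg h0]
    refine chainIntegral_congr hc fun w hw => ?_
    have hw0 : w ≠ 0 := fun h => h0 (h ▸ hKA hw)
    simp [hψ_def, hw0]

lemma eq_of_exp_eq_of_norm_sub_lt {u v : ℂ} (h : Complex.exp u = Complex.exp v)
    (huv : ‖u - v‖ < 2 * π) : u = v := by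
  obtain ⟨n, hn⟩ := Complex.exp_eq_exp_iff_exists_int.1 h
  have h1 : u - v = n * (2 * π * Complex.I) := by rw [hn]; ring
  have h2 : ‖u - v‖ = |(n : ℝ)| * (2 * π) := by
    rw [h1]
    simp [abs_of_pos Real.pi_pos]
  have h3 : |(n : ℝ)| < 1 := by
    rw [h2] at huv
    nlinarith [Real.pi_pos]
  have h4 : n = 0 := Int.abs_lt_one_iff.1 (by exact_mod_cast h3)
  simpa [h4] using hn

lemma IsPreconnected.eq_of_exp_eq {X : Type*} [TopologicalSpace X] {S : Set X}
    (hS : IsPreconnected S) {W : X → ℂ} (hW : ContinuousOn W S) {C : ℂ}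
    (hC : ∀ x ∈ S, Complex.exp (W x) = C) {x y : X} (hx : x ∈ S) (hy : y ∈ S) : W x = W y := by
  refine hS.induction₂ (fun x y => W x = W y) (fun x hx => ?_) (fun _ _ _ _ _ _ h h' => h.trans h')
    (fun _ _ _ _ h => h.symm) hx hy
  have := (Metric.tendsto_nhds.1 (hW x hx)) (2 * π) (by positivity)
  filter_upwards [this, self_mem_nhdsWithin] with y hy hyS
  refine (eq_of_exp_eq_of_norm_sub_lt ((hC y hyS).trans (hC x hx).symm) ?_).symm
  rwa [← dist_eq_norm]

/-- `IsPolygonalPath K a b c` says that `c` is the chain of a polygonal path from `a` to `b`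
inside `K`. -/
inductive IsPolygonalPath (K : Set ℂ) (a : ℂ) : ℂ → ((ℂ × ℂ) →₀ ℤ) → Prop
  | refl (ha : a ∈ K) : IsPolygonalPath K a a 0
  | snoc {b d : ℂ} {c : (ℂ × ℂ) →₀ ℤ} (h : IsPolygonalPath K a b c) (hs : segment ℝ b d ⊆ K) :
      IsPolygonalPath K a d (c + Finsupp.single (b, d) 1)

namespace IsPolygonalPath

variable {K L : Set ℂ} {a b d : ℂ} {c c' : (ℂ × ℂ) →₀ ℤ}

lemma left_mem (h : IsPolygonalPath K a b c) : a ∈ K := by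
  induction h with
  | refl ha => exact ha
  | snoc _ _ ih => exact ih

lemma right_mem (h : IsPolygonalPath K a b c) : b ∈ K := by
  cases h with
  | refl ha => exact ha
  | snoc _ hs => exact hs (right_mem_segment ..)

lemma of_segment_subset (h : segment ℝ a b ⊆ K) :
    IsPolygonalPath K a b (Finsupp.single (a, b) 1) := by
  simpa using (refl (h (left_mem_segment ..))).snoc h

lemma mono (h : IsPolygonalPath K a b c) (hKL : K ⊆ L) : IsPolygonalPath L a b c := by
  induction h with
  | refl ha => exact refl (hKL ha)
  | snoc _ hs ih => exact ih.snoc (hs.trans hKL)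

lemma trans (h : IsPolygonalPath K a b c) (h' : IsPolygonalPath K b d c') :
    IsPolygonalPath K a d (c + c') := by
  induction h' with
  | refl _ => simpa using h
  | snoc _ hs ih => simpa [add_assoc] using ih.snoc hs

lemma chainIn (h : IsPolygonalPath K a b c) : ChainIn K c := by
  induction h with
  | refl _ => intro e he; simp at he
  | snoc _ hs ih => exact ih.add (.single hs 1)

lemma exists_isCompact (h : IsPolygonalPath K a b c) :
    ∃ L ⊆ K, IsCompact L ∧ IsPolygonalPath L a b c := by
  induction h with
  | refl ha => exact ⟨{a}, by simpa, isCompact_singleton, refl rfl⟩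
  | @snoc b d c _ hs ih =>
    obtain ⟨L, hLK, hL, h⟩ := ih
    refine ⟨L ∪ segment ℝ b d, union_subset hLK hs, hL.union ?_,
      (h.mono subset_union_left).snoc subset_union_right⟩
    rw [segment_eq_image_lineMap]
    exact isCompact_Icc.image (by fun_prop)

lemma exp_chainIntegral_inv_sub (h : IsPolygonalPath K a b c) {z : ℂ} (hz : z ∉ K) :
    Complex.exp (chainIntegral (fun w => (w - z)⁻¹) c) = (b - z) / (a - z) := by
  have hne : ∀ w ∈ K, w - z ≠ 0 := fun w hw => sub_ne_zero.2 fun h => hz (h ▸ hw)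
  have ha := hne a h.left_mem
  induction h with
  | refl _ => simp [chainIntegral_zero, ha]
  | @snoc b d c h hs ih =>
    have hb := hne b (hs (left_mem_segment ..))
    have hd := hne d (hs (right_mem_segment ..))
    rw [chainIntegral_add, Complex.exp_add, ih, chainIntegral_single,
      segmentIntegral_inv_sub fun hh => hz (hs hh), Int.cast_one, one_mul,
      Complex.exp_log (div_ne_zero hd hb)]
    field_simp

end IsPolygonalPath

/-- Two points of a connected open set are joined by a polygonal path. -/
lemma IsPreconnected.exists_isPolygonalPath {A : Set ℂ} (hA : IsOpen A) (hAc : IsPreconnected A)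
    {a b : ℂ} (ha : a ∈ A) (hb : b ∈ A) : ∃ c, IsPolygonalPath A a b c := by
  refine hAc.induction₂' (fun a b => ∃ c, IsPolygonalPath A a b c) (fun x hx => ?_) ?_ ha hb
  · obtain ⟨r, hr, hrA⟩ := Metric.isOpen_iff.1 hA x hx
    filter_upwards [mem_nhdsWithin_of_mem_nhds (ball_mem_nhds x hr)] with y hy
    have hx' := mem_ball_self (x := x) hr
    exact ⟨⟨_, .of_segment_subset (((convex_ball x r).segment_subset hx' hy).trans hrA)⟩,
      ⟨_, .of_segment_subset (((convex_ball x r).segment_subset hy hx').trans hrA)⟩⟩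
  · rintro x y z - - - ⟨c, hc⟩ ⟨d, hd⟩
    exact ⟨_, hc.trans hd⟩

/-- On a disk, the integral of `F' / F` along a chord computes the change of any continuous
logarithm of `F` along a curve in the disk with the same endpoints. -/
lemma segmentIntegral_deriv_div_eq_sub {x : ℂ} {r : ℝ} {F : ℂ → ℂ}
    (hF : DifferentiableOn ℂ F (ball x r)) (hF0 : ∀ w ∈ ball x r, F w ≠ 0) {γ g : ℝ → ℂ}
    {I : Set ℝ} (hI : IsPreconnected I) (hγ : ContinuousOn γ I) (hg : ContinuousOn g I)
    (hγI : MapsTo γ I (ball x r)) (hgF : ∀ τ ∈ I, Complex.exp (g τ) = F (γ τ)) {s t : ℝ}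
    (hs : s ∈ I) (ht : t ∈ I) :
    segmentIntegral (fun w => deriv F w / F w) (γ s) (γ t) = g t - g s := by
  have hφ : DifferentiableOn ℂ (fun w => deriv F w / F w) (ball x r) :=
    (hF.deriv isOpen_ball).div hF hF0
  obtain ⟨P, hP⟩ := hφ.isExactOn_ball
  have hseg := (convex_ball x r).segment_subset (hγI hs) (hγI ht)
  rw [segmentIntegral_eq_sub (fun w hw => hP w (hseg hw)) (hφ.continuousOn.mono hseg)]
  have hQ : ∀ w ∈ ball x r, HasDerivAt (fun w => F w * Complex.exp (-P w)) 0 w := by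
    intro w hw
    have h1 := (hF.differentiableAt (isOpen_ball.mem_nhds hw)).hasDerivAt
    refine (h1.mul (hP w hw).fun_neg.cexp).congr_deriv ?_
    have := hF0 w hw
    field_simp
    ring
  obtain ⟨C, hC⟩ := isOpen_ball.exists_is_const_of_deriv_eq_zero (convex_ball x r).isPreconnected
    (fun w hw => (hQ w hw).differentiableAt.differentiableWithinAt) fun w hw => (hQ w hw).deriv
  have hPc : ContinuousOn P (ball x r) := fun w hw => (hP w hw).continuousAt.continuousWithinAt
  have key := hI.eq_of_exp_eq (W := fun τ => g τ - P (γ τ)) (C := C)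
    (hg.sub (hPc.comp hγ hγI)) (fun τ hτ => ?_) hs ht
  · linear_combination key
  · rw [sub_eq_add_neg, Complex.exp_add, hgF τ hτ, hC _ (hγI hτ)]

/-- A curve in an open set can be replaced by a polygonal path along which the integral of `F' / F`
is the change of `log F` along the curve. -/
lemma exists_isPolygonalPath_chainIntegral_deriv_div {A : Set ℂ} (hA : IsOpen A) {γ : ℝ → ℂ}
    (hγ : Continuous γ) (hγA : ∀ t, γ t ∈ A) (s t : ℝ) :
    ∃ c, IsPolygonalPath A (γ s) (γ t) c ∧ ∀ F g : ℂ → ℂ, ∀ l : ℝ → ℂ, DifferentiableOn ℂ F A →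
      (∀ z ∈ A, F z ≠ 0) → Continuous l → (∀ τ, Complex.exp (l τ) = F (γ τ)) →
      EqOn g (fun w => deriv F w / F w) A → chainIntegral g c = l t - l s := by
  refine isPreconnected_univ.induction₂' (fun s t => ∃ c, IsPolygonalPath A (γ s) (γ t) c ∧
    ∀ F g : ℂ → ℂ, ∀ l : ℝ → ℂ, DifferentiableOn ℂ F A → (∀ z ∈ A, F z ≠ 0) → Continuous l →
      (∀ τ, Complex.exp (l τ) = F (γ τ)) → EqOn g (fun w => deriv F w / F w) A →
      chainIntegral g c = l t - l s) (fun s _ => ?_) ?_ (mem_univ s) (mem_univ t)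
  · obtain ⟨r, hr, hrA⟩ := Metric.isOpen_iff.1 hA (γ s) (hγA s)
    obtain ⟨δ, hδ, hδr⟩ := Metric.mem_nhds_iff.1 (hγ.continuousAt (ball_mem_nhds (γ s) hr))
    have key : ∀ u ∈ ball s δ, ∀ v ∈ ball s δ, ∃ c, IsPolygonalPath A (γ u) (γ v) c ∧
        ∀ F g : ℂ → ℂ, ∀ l : ℝ → ℂ, DifferentiableOn ℂ F A → (∀ z ∈ A, F z ≠ 0) → Continuous l →
        (∀ τ, Complex.exp (l τ) = F (γ τ)) → EqOn g (fun w => deriv F w / F w) A →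
        chainIntegral g c = l v - l u := by
      intro u hu v hv
      have hseg := ((convex_ball (γ s) r).segment_subset (hδr hu) (hδr hv)).trans hrA
      refine ⟨_, .of_segment_subset hseg, fun F g l hF hF0 hl hlF hg => ?_⟩
      rw [chainIntegral_single, Int.cast_one, one_mul, segmentIntegral_congr (hg.mono hseg)]
      exact segmentIntegral_deriv_div_eq_sub (hF.mono hrA) (fun w hw => hF0 w (hrA hw))
        (convex_ball s δ).isPreconnected hγ.continuousOn hl.continuousOn hδr (fun τ _ => hlF τ)
        hu hv
    filter_upwards [mem_nhdsWithin_of_mem_nhds (ball_mem_nhds s hδ)] with t ht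
    exact ⟨key s (mem_ball_self hδ) t ht, key t ht s (mem_ball_self hδ)⟩
  · rintro s t u - - - ⟨c, hc, hcl⟩ ⟨d, hd, hdl⟩
    refine ⟨_, hc.trans hd, fun F g l hF hF0 hl hlF hg => ?_⟩
    rw [chainIntegral_add, hcl F g l hF hF0 hl hlF hg, hdl F g l hF hF0 hl hlF hg]
    ring

/-- A holomorphic function with path-independent polygonal integrals has a primitive. -/
lemma exists_hasDerivAt_of_chainIntegral_eq {A : Set ℂ} (hA : IsOpen A) (hAc : IsConnected A)
    {φ : ℂ → ℂ} (hφ : DifferentiableOn ℂ φ A)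
    (hind : ∀ a b c d, IsPolygonalPath A a b c → IsPolygonalPath A a b d →
      chainIntegral φ c = chainIntegral φ d) :
    ∃ L : ℂ → ℂ, ∀ z ∈ A, HasDerivAt L (φ z) z := by
  obtain ⟨a, ha⟩ := hAc.nonempty
  choose! c hc using fun z (hz : z ∈ A) => hAc.isPreconnected.exists_isPolygonalPath hA ha hz
  refine ⟨fun z => chainIntegral φ (c z), fun z hz => ?_⟩
  obtain ⟨r, hr, hrA⟩ := Metric.isOpen_iff.1 hA z hz
  obtain ⟨P, hP⟩ := (hφ.mono hrA).isExactOn_ball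
  refine ((hP z (mem_ball_self hr)).const_add
    (chainIntegral φ (c z) - P z)).congr_of_eventuallyEq ?_
  filter_upwards [ball_mem_nhds z hr] with w hw
  have hseg := (convex_ball z r).segment_subset (mem_ball_self hr) hw
  rw [hind a w (c w) _ (hc w (hrA hw)) ((hc z hz).snoc (hseg.trans hrA)), chainIntegral_add,
    chainIntegral_single, segmentIntegral_eq_sub (fun v hv => hP v (hseg hv))
    (hφ.continuousOn.mono (hseg.trans hrA))]
  simp only [Int.cast_one]
  ring

/-- If the complement of `A` has a single bounded component, then a chain in `A` with integer
winding numbers, which vanish on this component, is null-homologous in `A`. -/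
lemma chainIntegral_eq_zero_of_existsUnique_bounded {A K : Set ℂ} (hA : IsOpen A)
    (hone : ∃! B : Set ℂ, B.Nonempty ∧ Bornology.IsBounded B ∧
      ∃ x ∉ A, B = connectedComponentIn Aᶜ x) {z₀ : ℂ} (hz₀ : z₀ ∉ A)
    (hz₀b : Bornology.IsBounded (connectedComponentIn Aᶜ z₀))
    (hK : IsCompact K) (hKA : K ⊆ A) {c : (ℂ × ℂ) →₀ ℤ} (hc : ChainIn K c)
    (hexp : ∀ z ∉ K, Complex.exp (chainIntegral (fun w => (w - z)⁻¹) c) = 1)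
    (hc0 : chainIntegral (fun w => (w - z₀)⁻¹) c = 0)
    {φ : ℂ → ℂ} (hφ : DifferentiableOn ℂ φ A) : chainIntegral φ c = 0 := by
  set W : ℂ → ℂ := fun z => chainIntegral (fun w => (w - z)⁻¹) c
  have hWcont : ∀ z ∉ K, ContinuousAt W z := fun z hz => by
    simpa only [one_div] using (differentiableAt_chainIntegral_div_sub hK hc
      (ψ := fun _ => 1) continuousOn_const hz).continuousAt
  have hzero : ∀ z ∉ K, dist (W z) 0 < 2 * π → W z = 0 := fun z hz h =>
    eq_of_exp_eq_of_norm_sub_lt ((hexp z hz).trans Complex.exp_zero.symm)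
      (by rwa [← dist_eq_norm])
  have hWinf : ∀ᶠ z in cocompact ℂ, W z = 0 := by
    have ht : Tendsto W (cocompact ℂ) (𝓝 0) := by
      simpa only [one_div] using tendsto_chainIntegral_div_sub hK hc
        (ψ := fun _ => 1) continuousOn_const
    filter_upwards [Metric.tendsto_nhds.1 ht (2 * π) (by positivity), hK.compl_mem_cocompact]
      with z h1 h2 using hzero z h2 h1
  have hWcomp : ∀ x, ∀ y ∈ connectedComponentIn Aᶜ x, ∀ z ∈ connectedComponentIn Aᶜ x,
      W y = W z := by
    intro x y hy z hz
    have hsub : ∀ w ∈ connectedComponentIn Aᶜ x, w ∉ K := fun w hw hwK =>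
      connectedComponentIn_subset _ _ hw (hKA hwK)
    exact isPreconnected_connectedComponentIn.eq_of_exp_eq
      (fun w hw => (hWcont w (hsub w hw)).continuousWithinAt) (fun w hw => hexp w (hsub w hw)) hy hz
  have hWA : ∀ x ∉ A, W x = 0 := by
    intro x hx
    have hxmem := mem_connectedComponentIn (F := Aᶜ) hx
    by_cases hb : Bornology.IsBounded (connectedComponentIn Aᶜ x)
    · have hz₀mem := mem_connectedComponentIn (F := Aᶜ) hz₀
      have := hone.unique ⟨⟨x, hxmem⟩, hb, x, hx, rfl⟩ ⟨⟨z₀, hz₀mem⟩, hz₀b, z₀, hz₀, rfl⟩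
      rw [hWcomp x x hxmem z₀ (this ▸ hz₀mem)]
      exact hc0
    · obtain ⟨z, hz, hWz⟩ : ∃ z ∈ connectedComponentIn Aᶜ x, W z = 0 := by
        by_contra! hne
        refine hb (Bornology.isBounded_def.2 ?_)
        rw [Metric.cobounded_eq_cocompact]
        filter_upwards [hWinf] with z hz hzx using hne z hzx hz
      rw [hWcomp x x hxmem z hz, hWz]
  refine chainIntegral_eq_zero hA hK hKA hc (fun z hz => ?_) hWinf hφ
  have hzK : z ∉ K := fun h => hz (hKA h)
  have ht := hWcont z hzK
  rw [ContinuousAt, hWA z hz] at ht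
  filter_upwards [Metric.tendsto_nhds.1 ht (2 * π) (by positivity),
    hK.isClosed.isOpen_compl.mem_nhds hzK] with z' h1 h2 using hzero z' h2 h1

/-- Let `A ⊆ ℂ` be an open connected set whose complement has exactly one bounded
component, and `f` holomorphic and zero-free on `A` with `f'` zero-free on `A`.  If the
winding number of `f` along a core curve `γ` of the annular region `A` (a closed curve in
`A` winding once around the bounded complementary component) is `N ≥ 1` — i.e. the change
of `arg f` along `γ` is `2πN` — then `f` has a holomorphic `N`-th root on `A`. -/
theorem stmt15 (A : Set ℂ) (hA : IsOpen A) (hAc : IsConnected A)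
    (hone : ∃! B : Set ℂ, B.Nonempty ∧ Bornology.IsBounded B ∧
      ∃ x ∉ A, B = connectedComponentIn Aᶜ x)
    (f : ℂ → ℂ) (hf : DifferentiableOn ℂ f A) (hnz : ∀ z ∈ A, f z ≠ 0)
    (hf' : ∀ z ∈ A, deriv f z ≠ 0)
    (N : ℕ) (hN : 1 ≤ N)
    (γ : ℝ → ℂ) (hγ : Continuous γ) (hγmem : ∀ t, γ t ∈ A) (hloop : γ 0 = γ 1)
    (z₀ : ℂ) (hz₀ : z₀ ∉ A)
    (hz₀b : Bornology.IsBounded (connectedComponentIn Aᶜ z₀))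
    -- `γ` winds once around the bounded complementary component:
    (h : ℝ → ℂ) (hh : Continuous h) (hhlift : ∀ t, Complex.exp (h t) = γ t - z₀)
    (hwind1 : h 1 - h 0 = 2 * π * Complex.I)
    -- the change of `arg f` along `γ` is `2πN`:
    (g : ℝ → ℂ) (hg : Continuous g) (hglift : ∀ t, Complex.exp (g t) = f (γ t))
    (hwindN : g 1 - g 0 = 2 * π * (N : ℂ) * Complex.I) :
    ∃ φ : ℂ → ℂ, DifferentiableOn ℂ φ A ∧ ∀ z ∈ A, (φ z) ^ N = f z := by
  have hN0 : (N : ℂ) ≠ 0 := by exact_mod_cast (by lia : N ≠ 0)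
  have hne : ∀ z ∈ A, z - z₀ ≠ 0 := fun z hz => sub_ne_zero.2 fun e => hz₀ (e ▸ hz)
  have hψ : DifferentiableOn ℂ (fun w => deriv f w / f w) A := (hf.deriv hA).div hf hnz
  have hinv : DifferentiableOn ℂ (fun w => (w - z₀)⁻¹) A :=
    DifferentiableOn.inv (by fun_prop) hne
  set φ : ℂ → ℂ := fun w => deriv f w / f w - N * (w - z₀)⁻¹
  have hφ : DifferentiableOn ℂ φ A := hψ.sub (hinv.const_mul _)
  obtain ⟨d, hd, hdl⟩ := exists_isPolygonalPath_chainIntegral_deriv_div hA hγ hγmem 0 1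
  have hd1 : chainIntegral (fun w => (w - z₀)⁻¹) d = 2 * π * Complex.I := by
    rw [← hwind1]
    refine hdl (fun w => w - z₀) _ h (by fun_prop) hne hh hhlift fun w _ => ?_
    simp
  have hdφ : chainIntegral φ d = 0 := by
    rw [chainIntegral_sub_mul hd.chainIn _ hψ.continuousOn hinv.continuousOn, hd1,
      hdl f _ g hf hnz hg hglift fun _ _ => rfl, hwindN]
    ring
  obtain ⟨L, hL⟩ := exists_hasDerivAt_of_chainIntegral_eq hA hAc hφ fun a b c₁ c₂ h₁ h₂ => by
    obtain ⟨K₁, hK₁A, hK₁, h₁⟩ := h₁.exists_isCompact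
    obtain ⟨K₂, hK₂A, hK₂, h₂⟩ := h₂.exists_isCompact
    obtain ⟨K₃, hK₃A, hK₃, hd⟩ := hd.exists_isCompact
    set K := K₁ ∪ K₂ ∪ K₃
    have hKA : K ⊆ A := union_subset (union_subset hK₁A hK₂A) hK₃A
    replace h₁ : IsPolygonalPath K a b c₁ := h₁.mono fun z hz => .inl (.inl hz)
    replace h₂ : IsPolygonalPath K a b c₂ := h₂.mono fun z hz => .inl (.inr hz)
    replace hd : IsPolygonalPath K (γ 0) (γ 1) d := hd.mono fun z hz => .inr hz
    have hsub : ∀ z ∉ K, Complex.exp (chainIntegral (fun w => (w - z)⁻¹) (c₁ - c₂)) = 1 := by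
      intro z hz
      rw [chainIntegral_sub, Complex.exp_sub, h₁.exp_chainIntegral_inv_sub hz,
        ← h₂.exp_chainIntegral_inv_sub hz, div_self (Complex.exp_ne_zero _)]
    obtain ⟨k, hk⟩ := Complex.exp_eq_one_iff.1 (hsub z₀ fun hz => hz₀ (hKA hz))
    have key : chainIntegral φ (c₁ - c₂ - k • d) = 0 := by
      refine chainIntegral_eq_zero_of_existsUnique_bounded hA hone hz₀ hz₀b
        ((hK₁.union hK₂).union hK₃) hKA ((h₁.chainIn.sub h₂.chainIn).sub (hd.chainIn.zsmul k))
        (fun z hz => ?_) ?_ hφ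
      · have hz0 : γ 1 - z ≠ 0 := sub_ne_zero.2 fun e => hz (e ▸ hd.right_mem)
        rw [chainIntegral_sub, Complex.exp_sub, hsub z hz, chainIntegral_zsmul,
          Complex.exp_int_mul, hd.exp_chainIntegral_inv_sub hz, hloop, div_self hz0]
        simp
      · rw [chainIntegral_sub, chainIntegral_zsmul, hk, hd1, sub_self]
    rw [chainIntegral_sub, chainIntegral_sub, chainIntegral_zsmul, hdφ] at key
    linear_combination key
  have hQ : ∀ w ∈ A, HasDerivAt (fun w => f w * ((w - z₀) ^ N * Complex.exp (L w))⁻¹) 0 w := by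
    intro w hw
    have h1 := (hf.differentiableAt (hA.mem_nhds hw)).hasDerivAt
    have h2 := (((hasDerivAt_id w).sub_const z₀).pow N).mul (hL w hw).cexp
    have h0 := hne w hw
    have hfw := hnz w hw
    have hexp := Complex.exp_ne_zero (L w)
    refine (h1.mul (h2.inv (mul_ne_zero (pow_ne_zero N h0) hexp))).congr_deriv ?_
    obtain ⟨M, rfl⟩ : ∃ M, N = M + 1 := ⟨N - 1, by lia⟩
    simp only [φ, id, Pi.mul_apply, Pi.pow_apply, Pi.inv_apply, Nat.add_sub_cancel]
    field_simp
    ring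
  obtain ⟨C, hC⟩ := hA.exists_is_const_of_deriv_eq_zero hAc.isPreconnected
    (fun w hw => (hQ w hw).differentiableAt.differentiableWithinAt) fun w hw => (hQ w hw).deriv
  refine ⟨fun z => C ^ (N⁻¹ : ℂ) * ((z - z₀) * Complex.exp (L z / N)), ?_, fun z hz => ?_⟩
  · have hLd : DifferentiableOn ℂ L A := fun z hz =>
      (hL z hz).differentiableAt.differentiableWithinAt
    fun_prop
  · have h0 := hne z hz
    have hexp := Complex.exp_ne_zero (L z)
    rw [mul_pow, mul_pow, Complex.cpow_nat_inv_pow _ (by lia), ← Complex.exp_nat_mul,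
      mul_div_cancel₀ _ hN0, ← hC z hz]
    field_simp
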